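/- Let (Z_n)_{n≥1} be nonnegative real-valued random variables such that Λ(λ) := lim_{n→∞} (1/n) log E e^{nλZ_n} exists in the extended reals for every λ ∈ ℝ, and set Λ*(D) := sup_{λ ≤ 0}[λD − Λ(λ)] and Λ_n*(D) := (1/n) sup_{λ ≤ 0}[λD − log E e^{λZ_n}]. Then limsup_{n→∞} −Λ_n*(D) ≤ −Λ*(D) for every D; and if Λ* is strictly convex on an open interval (a,b), then lim_{n→∞} −Λ_n*(D) = −Λ*(D) for every D ∈ (a, b]. -/

import Mathlib

open MeasureTheory Filter Set Topology Classical
open scoped ENNReal NNReal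

noncomputable section

/-- `-log t` as a value in `ℝ≥0∞` (equal to `∞` when `t = 0`); intended for `t ≤ 1`. -/
def negLog (t : ℝ≥0∞) : ℝ≥0∞ :=
  if t = 0 then ∞ else ENNReal.ofReal (-Real.log t.toReal)

/-- `log t` as a value in `ℝ≥0∞` (equal to `∞` when `t = ∞`); intended for `t ≥ 1`. -/
def posLog (t : ℝ≥0∞) : ℝ≥0∞ :=
  if t = ∞ then ∞ else ENNReal.ofReal (Real.log t.toReal)

/-- The extended-real-valued logarithm of an `ℝ≥0∞` number. -/
def eLog (t : ℝ≥0∞) : EReal :=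
  if t = 0 then ⊥ else if t = ∞ then ⊤ else ((Real.log t.toReal : ℝ) : EReal)

/-- Relative entropy `H(μ‖ν)` (in nats), valued in `ℝ≥0∞`: it equals
`∫ log (dμ/dν) dμ` when `μ ≪ ν` (and `+∞` when this integral is not defined,
which for probability measures can only mean `+∞`), and `+∞` when `¬ μ ≪ ν`. -/
def relEnt {α : Type*} [MeasurableSpace α] (μ ν : Measure α) : ℝ≥0∞ :=
  if μ ≪ ν ∧ Integrable (llr μ ν) μ then ENNReal.ofReal (∫ x, llr μ ν x ∂μ) else ∞

/-- The set `W(P,D)` of couplings: probability measures on `S × T` with first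
marginal `P` and expected distortion at most `D`. -/
def distSet {S T : Type*} [MeasurableSpace S] [MeasurableSpace T]
    (ρ : S × T → ℝ) (P : Measure S) (D : ℝ) : Set (Measure (S × T)) :=
  {W | IsProbabilityMeasure W ∧ W.map Prod.fst = P ∧
    ((∫⁻ z, ENNReal.ofReal (ρ z) ∂W : ℝ≥0∞) : EReal) ≤ ((D : ℝ) : EReal)}

/-- The rate function `R(P,Q,D) = inf_{W ∈ W(P,D)} H(W‖P×Q)` (equal to `+∞`
when `W(P,D)` is empty). -/
def Rrate {S T : Type*} [MeasurableSpace S] [MeasurableSpace T]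
    (ρ : S × T → ℝ) (P : Measure S) (Q : Measure T) (D : ℝ) : ℝ≥0∞ :=
  ⨅ W ∈ distSet ρ P D, relEnt W (P.prod Q)

/-- `Λ(P,Q,λ) = E_X[log E_Y e^{λρ(X,Y)}]`, valued in `EReal`.
For `λ ≥ 0` the integrand lies in `[0,∞]`; for `λ < 0` it lies in `[-∞,0]`. -/
def Lam {S T : Type*} [MeasurableSpace S] [MeasurableSpace T]
    (ρ : S × T → ℝ) (P : Measure S) (Q : Measure T) (l : ℝ) : EReal :=
  if 0 ≤ l then
    ((∫⁻ x, posLog (∫⁻ y, ENNReal.ofReal (Real.exp (l * ρ (x, y))) ∂Q) ∂P : ℝ≥0∞) : EReal)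
  else
    -(((∫⁻ x, negLog (∫⁻ y, ENNReal.ofReal (Real.exp (l * ρ (x, y))) ∂Q) ∂P : ℝ≥0∞) : EReal))

/-- The Fenchel–Legendre transform `Λ*(P,Q,D) = sup_{λ ≤ 0} [λD - Λ(P,Q,λ)]`. -/
def LamStar {S T : Type*} [MeasurableSpace S] [MeasurableSpace T]
    (ρ : S × T → ℝ) (P : Measure S) (Q : Measure T) (D : ℝ) : EReal :=
  ⨆ l ∈ Iic (0 : ℝ), (((l * D : ℝ) : EReal) - Lam ρ P Q l)

/-- `ρ_Q(x) := essinf_{Y ∼ Q} ρ(x,Y)`. -/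
def rhoQ {S T : Type*} [MeasurableSpace T]
    (ρ : S × T → ℝ) (Q : Measure T) (x : S) : ℝ :=
  essInf (fun y => ρ (x, y)) Q

/-- `D_min(P,Q) := inf {D : Λ*(P,Q,D) < ∞}`. -/
def DminPQ {S T : Type*} [MeasurableSpace S] [MeasurableSpace T]
    (ρ : S × T → ℝ) (P : Measure S) (Q : Measure T) : ℝ :=
  sInf {D : ℝ | LamStar ρ P Q D ≠ ⊤}

/-- `D_ave(P,Q) := E ρ(X,Y)` for independent `X ∼ P`, `Y ∼ Q`, valued in `ℝ≥0∞`. -/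
def DavePQ {S T : Type*} [MeasurableSpace S] [MeasurableSpace T]
    (ρ : S × T → ℝ) (P : Measure S) (Q : Measure T) : ℝ≥0∞ :=
  ∫⁻ z, ENNReal.ofReal (ρ z) ∂(P.prod Q)

/-- The candidate derivative `Λ'(λ)` of `Λ(P,Q,·)`. -/
def LamD {S T : Type*} [MeasurableSpace S] [MeasurableSpace T]
    (ρ : S × T → ℝ) (P : Measure S) (Q : Measure T) (l : ℝ) : ℝ :=
  ∫ x, (∫ y, ρ (x, y) * Real.exp (l * ρ (x, y)) ∂Q) /
    (∫ y, Real.exp (l * ρ (x, y)) ∂Q) ∂P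

/-- The left shift on sequences. -/
def shiftSeq {α : Type*} (x : ℕ → α) (n : ℕ) : α := x (n + 1)

/-- The single-letter distortion measure `ρ_n` on `n`-strings. -/
def rhoFin {S T : Type*} (ρ : S × T → ℝ) (n : ℕ) (x : Fin n → S) (y : Fin n → T) : ℝ :=
  (n : ℝ)⁻¹ * ∑ k, ρ (x k, y k)

/-- `L_n(x_1^n, Q^n, D) = -(1/n) log Q^n(B_n(x_1^n,D))`, valued in `ℝ≥0∞`,
for a memoryless (product) codebook distribution `Q^n`. -/
def LnIID {S T : Type*} [MeasurableSpace T]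
    (ρ : S × T → ℝ) (Q : Measure T) (D : ℝ) (n : ℕ) (x : ℕ → S) : ℝ≥0∞ :=
  (n : ℝ≥0∞)⁻¹ *
    negLog ((Measure.pi fun _ : Fin n => Q) {y | rhoFin ρ n (fun k => x k) y ≤ D})

/-- The empirical distribution `P_{x_1^n} = (1/n) ∑_{k=1}^n δ_{x_k}`. -/
def empMeas {S : Type*} [MeasurableSpace S] (n : ℕ) (x : ℕ → S) : Measure S :=
  (n : ℝ≥0∞)⁻¹ • ∑ k ∈ Finset.range n, Measure.dirac (x k)

/-- The `n`-dimensional marginal of a measure on sequences. -/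
def margN {α : Type*} [MeasurableSpace α] (μ : Measure (ℕ → α)) (n : ℕ) :
    Measure (Fin n → α) :=
  μ.map fun x (k : Fin n) => x (k : ℕ)

/-- The strong mixing condition `C⁻¹ 𝒬(A) 𝒬(B) ≤ 𝒬(A ∩ B) ≤ C 𝒬(A) 𝒬(B)` for all
`A ∈ σ(Y_1^n)`, `B ∈ σ(Y_{n+1}^∞)` and all `n`. -/
def Mixing {T : Type*} [MeasurableSpace T] (𝒬 : Measure (ℕ → T)) (C : ℝ) : Prop :=
  ∀ (n : ℕ) (A B : Set (ℕ → T)),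
    MeasurableSet[MeasurableSpace.comap (fun y (k : Fin n) => y (k : ℕ)) inferInstance] A →
    MeasurableSet[MeasurableSpace.comap (fun y (k : ℕ) => y (k + n)) inferInstance] B →
    (ENNReal.ofReal C)⁻¹ * (𝒬 A * 𝒬 B) ≤ 𝒬 (A ∩ B) ∧
      𝒬 (A ∩ B) ≤ ENNReal.ofReal C * (𝒬 A * 𝒬 B)

/-- `L_n(x_1^n, Q_n, D) = -(1/n) log Q_n(B_n(x_1^n,D))` where `Q_n` is the
`n`-dimensional marginal of the codebook process law `𝒬`. -/
def LnMem {S T : Type*} [MeasurableSpace T]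
    (ρ : S × T → ℝ) (𝒬 : Measure (ℕ → T)) (D : ℝ) (n : ℕ) (x : ℕ → S) : ℝ≥0∞ :=
  (n : ℝ≥0∞)⁻¹ * negLog (margN 𝒬 n {y | rhoFin ρ n (fun k => x k) y ≤ D})

/-- The set `W_n(P_n,D)` of couplings on `S^n × T^n`. -/
def distSetN {S T : Type*} [MeasurableSpace S] [MeasurableSpace T]
    (ρ : S × T → ℝ) (n : ℕ) (Pn : Measure (Fin n → S)) (D : ℝ) :
    Set (Measure ((Fin n → S) × (Fin n → T))) :=
  {W | IsProbabilityMeasure W ∧ W.map Prod.fst = Pn ∧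
    ((∫⁻ z, ENNReal.ofReal (rhoFin ρ n z.1 z.2) ∂W : ℝ≥0∞) : EReal) ≤ ((D : ℝ) : EReal)}

/-- `R_n(P_n,Q_n,D) = (1/n) inf_{W_n ∈ W_n(P_n,D)} H(W_n‖P_n×Q_n)`. -/
def RnMem {S T : Type*} [MeasurableSpace S] [MeasurableSpace T]
    (ρ : S × T → ℝ) (n : ℕ) (Pn : Measure (Fin n → S)) (Qn : Measure (Fin n → T))
    (D : ℝ) : ℝ≥0∞ :=
  (n : ℝ≥0∞)⁻¹ * ⨅ W ∈ distSetN ρ n Pn D, relEnt W (Pn.prod Qn)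

/-- `Λ_n(P_n,Q_n,λ) = E_{X_1^n}[log E_{Y_1^n} e^{λ ρ_n(X_1^n,Y_1^n)}]`. -/
def LamN {S T : Type*} [MeasurableSpace S] [MeasurableSpace T]
    (ρ : S × T → ℝ) (n : ℕ) (Pn : Measure (Fin n → S)) (Qn : Measure (Fin n → T))
    (l : ℝ) : EReal :=
  Lam (fun z => rhoFin ρ n z.1 z.2) Pn Qn l

/-- `Λ_n*(P_n,Q_n,D) = (1/n) sup_{λ ≤ 0} [λD - Λ_n(P_n,Q_n,λ)]`. -/
def LamStarN {S T : Type*} [MeasurableSpace S] [MeasurableSpace T]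
    (ρ : S × T → ℝ) (n : ℕ) (Pn : Measure (Fin n → S)) (Qn : Measure (Fin n → T))
    (D : ℝ) : EReal :=
  (((n : ℝ)⁻¹ : ℝ) : EReal) *
    ⨆ l ∈ Iic (0 : ℝ), (((l * D : ℝ) : EReal) - LamN ρ n Pn Qn l)

/-- One-sided Fenchel–Legendre transform `D ↦ sup_{λ ≤ 0} [λD - Λ(λ)]` of a
function `Λ : ℝ → EReal`. -/
def FLT (L : ℝ → EReal) (D : ℝ) : EReal :=
  ⨆ l ∈ Iic (0 : ℝ), (((l * D : ℝ) : EReal) - L l)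

theorem core17 (f : ℕ → ℝ → ℝ) (ℓ : ℝ → ℝ)
    (hf : ∀ l ≤ 0, Tendsto (fun n => f n l) atTop (𝓝 (ℓ l)))
    (hmono : ∀ n, ∀ l ≤ 0, ∀ m ≤ l, f n m ≤ f n l)
    (htail : ∀ n, ∀ M > 0, ∀ l ≤ -M, (-l) * f n (-M) ≤ M * f n l)
    (D D' C c0 : ℝ) (hD : D' < D) (hC : ∀ l ≤ 0, l * D' - ℓ l ≤ C)
    (hc : ∀ l ≤ 0, l * D - ℓ l ≤ c0) (hc0 : 0 ≤ c0) (ε : ℝ) (hε : 0 < ε) :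
    ∀ᶠ n in atTop, ∀ l ≤ 0, l * D - f n l ≤ c0 + ε := by
  have hDD : 0 < D - D' := sub_pos.2 hD
  obtain ⟨M, hM, hMC⟩ : ∃ M > 0, C < M * (D - D') := by
    refine ⟨(|C| + 1) / (D - D'), by positivity, ?_⟩
    rw [div_mul_cancel₀ _ hDD.ne']
    linarith [le_abs_self C]
  obtain ⟨δ, hδ, hδD⟩ : ∃ δ > 0, δ * |D| ≤ ε / 2 := by
    refine ⟨ε / (2 * (|D| + 1)), by positivity, ?_⟩
    rw [div_mul_eq_mul_div, div_le_div_iff₀ (by positivity) (by positivity)]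
    nlinarith [abs_nonneg D]
  have h1 : ∀ᶠ n in atTop, (-M) * D - f n (-M) < 0 := by
    have : Tendsto (fun n => (-M) * D - f n (-M)) atTop (𝓝 ((-M) * D - ℓ (-M))) :=
      tendsto_const_nhds.sub (hf _ (by linarith))
    refine this.eventually_lt_const ?_
    have := hC (-M) (by linarith)
    nlinarith
  have h2 : ∀ᶠ n in atTop, ∀ k ∈ Finset.range (⌈M / δ⌉₊ + 1),
      (-((k : ℝ) * δ)) * D - f n (-((k : ℝ) * δ)) < c0 + ε / 2 := by
    rw [Filter.eventually_all_finset]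
    intro k _
    have hk : -((k : ℝ) * δ) ≤ 0 := by
      have : 0 ≤ (k : ℝ) * δ := by positivity
      linarith
    have : Tendsto (fun n => (-((k : ℝ) * δ)) * D - f n (-((k : ℝ) * δ))) atTop
        (𝓝 ((-((k : ℝ) * δ)) * D - ℓ (-((k : ℝ) * δ)))) :=
      tendsto_const_nhds.sub (hf _ hk)
    refine this.eventually_lt_const ?_
    have := hc _ hk
    linarith
  filter_upwards [h1, h2] with n h1 h2 l hl
  by_cases hlM : l ≤ -M
  · have := htail n M hM l hlM
    have h3 : M * (l * D - f n l) ≤ 0 := by nlinarith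
    have : l * D - f n l ≤ 0 := by
      by_contra h
      push Not at h
      nlinarith
    linarith
  · push Not at hlM
    have hk1 : -l / δ ≤ (⌈-l / δ⌉₊ : ℝ) := Nat.le_ceil _
    have hk2 : (⌈-l / δ⌉₊ : ℝ) < -l / δ + 1 := Nat.ceil_lt_add_one (div_nonneg (by linarith) hδ.le)
    have hk3 : ⌈-l / δ⌉₊ ∈ Finset.range (⌈M / δ⌉₊ + 1) := by
      rw [Finset.mem_range, Nat.lt_succ_iff]
      exact Nat.ceil_le_ceil (by gcongr; linarith)
    have h3 := h2 _ hk3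
    generalize (⌈-l / δ⌉₊ : ℝ) = k at *
    rw [div_le_iff₀ hδ] at hk1
    have hk2' : k * δ < -l + δ := by
      have := mul_lt_mul_of_pos_right hk2 hδ
      rw [add_mul, div_mul_cancel₀ _ hδ.ne'] at this
      linarith
    have h4 := hmono n l hl (-(k * δ)) (by linarith)
    have h5 : (l + k * δ) * D ≤ δ * |D| := by
      calc (l + k * δ) * D ≤ (l + k * δ) * |D| :=
            mul_le_mul_of_nonneg_left (le_abs_self D) (by linarith)
        _ ≤ δ * |D| := mul_le_mul_of_nonneg_right (by linarith) (abs_nonneg D)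
    nlinarith

section
open ProbabilityTheory

theorem integrable17 {Ω : Type*} [MeasurableSpace Ω] (μ : Measure Ω) [IsProbabilityMeasure μ]
    (Y : Ω → ℝ) (hYm : Measurable Y) (hY0 : ∀ ω, 0 ≤ Y ω)
    (l : ℝ) (hl : l ≤ 0) : Integrable (fun ω => Real.exp (l * Y ω)) μ := by
  refine Integrable.of_bound (C := 1) (by fun_prop) (ae_of_all _ fun ω => ?_)
  rw [Real.norm_eq_abs, abs_of_pos (Real.exp_pos _), Real.exp_le_one_iff]
  exact mul_nonpos_of_nonpos_of_nonneg hl (hY0 ω)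

theorem eLog17 {Ω : Type*} [MeasurableSpace Ω] (μ : Measure Ω) [IsProbabilityMeasure μ]
    (Y : Ω → ℝ) (hYm : Measurable Y) (hY0 : ∀ ω, 0 ≤ Y ω)
    (l : ℝ) (hl : l ≤ 0) :
    eLog (∫⁻ ω, ENNReal.ofReal (Real.exp (l * Y ω)) ∂μ) = ((cgf Y μ l : ℝ) : EReal) := by
  have hi := integrable17 μ Y hYm hY0 l hl
  have hp := mgf_pos hi
  rw [← ofReal_integral_eq_lintegral_ofReal hi (ae_of_all _ fun ω => (Real.exp_pos _).le)]
  change eLog (ENNReal.ofReal (mgf Y μ l)) = _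
  rw [eLog, if_neg (by simpa using hp), if_neg (by simp), ENNReal.toReal_ofReal hp.le]
  rfl

theorem mono17 {Ω : Type*} [MeasurableSpace Ω] (μ : Measure Ω) [IsProbabilityMeasure μ]
    (Y : Ω → ℝ) (hYm : Measurable Y) (hY0 : ∀ ω, 0 ≤ Y ω)
    (l : ℝ) (hl : l ≤ 0) (m : ℝ) (hm : m ≤ l) : cgf Y μ m ≤ cgf Y μ l := by
  refine Real.log_le_log (mgf_pos (integrable17 μ Y hYm hY0 m (hm.trans hl))) ?_
  refine integral_mono (integrable17 μ Y hYm hY0 m (hm.trans hl))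
    (integrable17 μ Y hYm hY0 l hl) fun ω => ?_
  exact Real.exp_le_exp.2 (mul_le_mul_of_nonneg_right hm (hY0 ω))

theorem tail17 {Ω : Type*} [MeasurableSpace Ω] (μ : Measure Ω) [IsProbabilityMeasure μ]
    (Y : Ω → ℝ) (hYm : Measurable Y) (hY0 : ∀ ω, 0 ≤ Y ω)
    (M : ℝ) (hM : 0 < M) (l : ℝ) (hl : l ≤ -M) :
    (-l) * cgf Y μ (-M) ≤ M * cgf Y μ l := by
  have hq : 1 ≤ -l / M := by rw [le_div_iff₀ hM]; linarith
  have hi := integrable17 μ Y hYm hY0 (-M) (by linarith)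
  have hi' := integrable17 μ Y hYm hY0 l (by linarith)
  have he : ∀ ω, (Real.exp (-M * Y ω)) ^ (-l / M) = Real.exp (l * Y ω) := fun ω => by
    rw [← Real.exp_mul]
    congr 1
    field_simp
  have hj := (convexOn_rpow hq).map_integral_le (μ := μ) (f := fun ω => Real.exp (-M * Y ω))
    (Real.continuous_rpow_const (by linarith)).continuousOn isClosed_Ici
    (ae_of_all _ fun ω => (Real.exp_pos _).le) hi
    (by simpa only [Function.comp_def, he] using hi')
  simp only [he] at hj
  have hp := mgf_pos hi
  change (mgf Y μ (-M)) ^ (-l / M) ≤ mgf Y μ l at hj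
  have := Real.log_le_log (by positivity) hj
  rw [Real.log_rpow hp] at this
  change (-l / M) * cgf Y μ (-M) ≤ cgf Y μ l at this
  calc (-l) * cgf Y μ (-M) = M * ((-l / M) * cgf Y μ (-M)) := by field_simp
    _ ≤ _ := mul_le_mul_of_nonneg_left this hM.le

theorem le17 {Ω : Type*} [MeasurableSpace Ω] (μ : Measure Ω) [IsProbabilityMeasure μ]
    (Y : Ω → ℝ) (hYm : Measurable Y) (hY0 : ∀ ω, 0 ≤ Y ω)
    (n : ℕ) (hn : 0 < n) (D c : ℝ)
    (h : ∀ l ≤ 0, l * D - (n : ℝ)⁻¹ * cgf Y μ (n * l) ≤ c) :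
    (((n : ℝ)⁻¹ : ℝ) : EReal) *
        FLT (fun l => eLog (∫⁻ ω, ENNReal.ofReal (Real.exp (l * Y ω)) ∂μ)) D ≤ (c : EReal) := by
  have hn' : (0 : ℝ) < n := by exact_mod_cast hn
  have h1 : FLT (fun l => eLog (∫⁻ ω, ENNReal.ofReal (Real.exp (l * Y ω)) ∂μ)) D
      ≤ ((n * c : ℝ) : EReal) := by
    refine iSup₂_le fun l hl => ?_
    simp only [eLog17 μ Y hYm hY0 l hl]
    rw [← EReal.coe_sub, EReal.coe_le_coe_iff]
    have := h ((n : ℝ)⁻¹ * l) (mul_nonpos_of_nonneg_of_nonpos (by positivity) hl)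
    rw [mul_inv_cancel_left₀ hn'.ne', mul_assoc, ← mul_sub] at this
    rwa [inv_mul_le_iff₀ hn'] at this
  calc _ ≤ (((n : ℝ)⁻¹ : ℝ) : EReal) * ((n * c : ℝ) : EReal) :=
        mul_le_mul_of_nonneg_left h1 (by exact_mod_cast (inv_pos.2 hn').le)
    _ = _ := by rw [← EReal.coe_mul, inv_mul_cancel_left₀ hn'.ne']

theorem ge17 {Ω : Type*} [MeasurableSpace Ω] (μ : Measure Ω) [IsProbabilityMeasure μ]
    (Y : Ω → ℝ) (hYm : Measurable Y) (hY0 : ∀ ω, 0 ≤ Y ω)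
    (n : ℕ) (hn : 0 < n) (D l : ℝ) (hl : l ≤ 0) :
    ((l * D - (n : ℝ)⁻¹ * cgf Y μ (n * l) : ℝ) : EReal) ≤ (((n : ℝ)⁻¹ : ℝ) : EReal) *
        FLT (fun l => eLog (∫⁻ ω, ENNReal.ofReal (Real.exp (l * Y ω)) ∂μ)) D := by
  have hn' : (0 : ℝ) < n := by exact_mod_cast hn
  have hnl : (n : ℝ) * l ≤ 0 := mul_nonpos_of_nonneg_of_nonpos (by positivity) hl
  have h1 : ((n * l * D - cgf Y μ (n * l) : ℝ) : EReal) ≤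
      FLT (fun l => eLog (∫⁻ ω, ENNReal.ofReal (Real.exp (l * Y ω)) ∂μ)) D := by
    rw [EReal.coe_sub, ← eLog17 μ Y hYm hY0 _ hnl]
    exact le_iSup₂ (f := fun (l : ℝ) (_ : l ∈ Iic (0 : ℝ)) => (((l * D : ℝ) : EReal) -
      eLog (∫⁻ ω, ENNReal.ofReal (Real.exp (l * Y ω)) ∂μ))) ((n : ℝ) * l) hnl
  calc _ = (((n : ℝ)⁻¹ : ℝ) : EReal) * ((n * l * D - cgf Y μ (n * l) : ℝ) : EReal) := by
        rw [← EReal.coe_mul]; congr 1; field_simp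
    _ ≤ _ := mul_le_mul_of_nonneg_left h1 (by exact_mod_cast (inv_pos.2 hn').le)

end

/-- with `Λ_n*(D) = (1/n) sup_{λ ≤ 0}[λD - log E e^{λZ_n}]`,
`limsup_n (-Λ_n*(D)) ≤ -Λ*(D)` for every `D`; and if `Λ*` is strictly convex on
`(a,b)`, then `lim_n (-Λ_n*(D)) = -Λ*(D)` for all `D ∈ (a,b]`. -/
theorem stmt17 {Ω : Type*} [MeasurableSpace Ω] (ℙ : Measure Ω) [IsProbabilityMeasure ℙ]
    (Z : ℕ → Ω → ℝ) (hZm : ∀ n, Measurable (Z n)) (hZ0 : ∀ n ω, 0 ≤ Z n ω)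
    (L : ℝ → EReal)
    (hL : ∀ l : ℝ, Tendsto (fun n : ℕ => (((n : ℝ)⁻¹ : ℝ) : EReal) *
      eLog (∫⁻ ω, ENNReal.ofReal (Real.exp ((n : ℝ) * l * Z n ω)) ∂ℙ)) atTop
      (𝓝 (L l))) :
    (∀ D : ℝ, limsup (fun n : ℕ => -((((n : ℝ)⁻¹ : ℝ) : EReal) *
        FLT (fun l => eLog (∫⁻ ω, ENNReal.ofReal (Real.exp (l * Z n ω)) ∂ℙ)) D))
        atTop ≤ -(FLT L D)) ∧
    (∀ a b : ℝ, a < b →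
      (∀ D₁ ∈ Ioo a b, ∀ D₂ ∈ Ioo a b, D₁ ≠ D₂ → ∀ t : ℝ, 0 < t → t < 1 →
        FLT L (t * D₁ + (1 - t) * D₂) <
          ((t : ℝ) : EReal) * FLT L D₁ + (((1 - t : ℝ)) : EReal) * FLT L D₂) →
      ∀ D : ℝ, a < D → D ≤ b →
        Tendsto (fun n : ℕ => -((((n : ℝ)⁻¹ : ℝ) : EReal) *
          FLT (fun l => eLog (∫⁻ ω, ENNReal.ofReal (Real.exp (l * Z n ω)) ∂ℙ)) D))
          atTop (𝓝 (-(FLT L D)))) := by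
  have hE : ∀ n : ℕ, ∀ l ≤ 0, (((n : ℝ)⁻¹ : ℝ) : EReal) *
      eLog (∫⁻ ω, ENNReal.ofReal (Real.exp ((n : ℝ) * l * Z n ω)) ∂ℙ) =
      (((n : ℝ)⁻¹ * ProbabilityTheory.cgf (Z n) ℙ (n * l) : ℝ) : EReal) := fun n l hl => by
    rw [eLog17 ℙ (Z n) (hZm n) (hZ0 n) _ (mul_nonpos_of_nonneg_of_nonpos (by positivity) hl),
      EReal.coe_mul]
  have hL' : ∀ l ≤ 0, Tendsto (fun n : ℕ =>
      (((n : ℝ)⁻¹ * ProbabilityTheory.cgf (Z n) ℙ (n * l) : ℝ) : EReal)) atTop (𝓝 (L l)) :=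
    fun l hl => (hL l).congr fun n => hE n l hl
  have part1 : ∀ D : ℝ, limsup (fun n : ℕ => -((((n : ℝ)⁻¹ : ℝ) : EReal) *
        FLT (fun l => eLog (∫⁻ ω, ENNReal.ofReal (Real.exp (l * Z n ω)) ∂ℙ)) D))
        atTop ≤ -(FLT L D) := by
    intro D
    rw [EReal.le_neg]
    refine iSup₂_le fun l hl => ?_
    rw [EReal.le_neg]
    have ht : Tendsto (fun n : ℕ =>
        -((l * D - (n : ℝ)⁻¹ * ProbabilityTheory.cgf (Z n) ℙ (n * l) : ℝ) : EReal)) atTop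
        (𝓝 (-(((l * D : ℝ) : EReal) - L l))) := by
      have h1 : Tendsto (fun n : ℕ => (((l * D : ℝ) : EReal),
          -(((n : ℝ)⁻¹ * ProbabilityTheory.cgf (Z n) ℙ (n * l) : ℝ) : EReal))) atTop
          (𝓝 (((l * D : ℝ) : EReal), -L l)) :=
        tendsto_const_nhds.prodMk_nhds ((continuous_neg.tendsto _).comp (hL' l hl))
      have h2 := (EReal.continuousAt_add (p := (((l * D : ℝ) : EReal), -L l))
        (Or.inl (EReal.coe_ne_top _)) (Or.inl (EReal.coe_ne_bot _))).tendsto.comp h1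
      have h3 := (continuous_neg.tendsto _).comp h2
      refine h3.congr fun n => ?_
      rw [EReal.coe_sub, sub_eq_add_neg]
      rfl
    rw [← ht.limsup_eq]
    refine limsup_le_limsup ?_
    filter_upwards [eventually_gt_atTop 0] with n hn
    exact EReal.neg_le_neg_iff.2 (ge17 ℙ (Z n) (hZm n) (hZ0 n) n hn D l hl)
  refine ⟨part1, fun a b hab hconv D haD hDb => ?_⟩
  have hfin : ∀ x ∈ Ioo a b, FLT L x < ⊤ := by
    intro x hx
    have h1 : (a + x) / 2 ∈ Ioo a b := ⟨by linarith [hx.1], by linarith [hx.1, hx.2]⟩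
    obtain ⟨d, hd, hda, hdb⟩ : ∃ d > 0, a < x - d ∧ x + d < b := by
      refine ⟨min (x - a) (b - x) / 2, ?_, ?_, ?_⟩
      · have : 0 < min (x - a) (b - x) := lt_min (by linarith [hx.1]) (by linarith [hx.2])
        linarith
      · have := min_le_left (x - a) (b - x)
        linarith [hx.1]
      · have := min_le_right (x - a) (b - x)
        linarith [hx.2]
    have := hconv (x - d) ⟨hda, by linarith⟩ (x + d) ⟨by linarith, hdb⟩ (by linarith)
      (1 / 2) (by norm_num) (by norm_num)
    rw [show (1 / 2 : ℝ) * (x - d) + (1 - 1 / 2) * (x + d) = x by ring] at this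
    exact lt_top_of_lt this
  have hL0 : L 0 = 0 := by
    refine tendsto_nhds_unique (hL' 0 le_rfl) ?_
    simp
  have hge : ∀ x : ℝ, ∀ l ≤ 0, ((l * x : ℝ) : EReal) - L l ≤ FLT L x := fun x l hl =>
    le_iSup₂ (f := fun (l : ℝ) (_ : l ∈ Iic (0 : ℝ)) => (((l * x : ℝ) : EReal) - L l)) l hl
  have hnn : ∀ x : ℝ, 0 ≤ FLT L x := fun x => by
    simpa [hL0] using hge x 0 le_rfl
  have hanti : ∀ x y : ℝ, x ≤ y → FLT L y ≤ FLT L x := fun x y hxy => by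
    refine iSup₂_le fun l hl => le_trans ?_ (hge x l hl)
    refine EReal.sub_le_sub ?_ le_rfl
    exact EReal.coe_le_coe_iff.2 (mul_le_mul_of_nonpos_left hxy hl)
  have hD' : (a + D) / 2 ∈ Ioo a b := ⟨by linarith, by linarith⟩
  have hDD : (a + D) / 2 < D := by linarith
  generalize (a + D) / 2 = D' at hD' hDD
  obtain ⟨C, hC⟩ : ∃ C : ℝ, FLT L D' = C :=
    ⟨_, (EReal.coe_toReal (hfin D' hD').ne
      (ne_of_gt (lt_of_lt_of_le EReal.bot_lt_zero (hnn D')))).symm⟩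
  obtain ⟨c0, hc0⟩ : ∃ c : ℝ, FLT L D = c :=
    ⟨_, (EReal.coe_toReal ((hanti D' D hDD.le).trans_lt (hfin D' hD')).ne
      (ne_of_gt (lt_of_lt_of_le EReal.bot_lt_zero (hnn D)))).symm⟩
  have hLr : ∀ l ≤ 0, L l = ((L l).toReal : EReal) := by
    intro l hl
    refine (EReal.coe_toReal ?_ ?_).symm
    · have h0 : L l ≤ 0 := by
        rw [← hL0]
        refine le_of_tendsto_of_tendsto' (hL' l hl) (hL' 0 le_rfl) fun n => ?_
        rw [EReal.coe_le_coe_iff]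
        refine mul_le_mul_of_nonneg_left ?_ (by positivity)
        exact mono17 ℙ (Z n) (hZm n) (hZ0 n) _ (by simp) _
          (mul_le_mul_of_nonneg_left hl (by positivity))
      exact (h0.trans_lt EReal.zero_lt_top).ne
    · intro h
      have := hge D' l hl
      rw [h, hC, EReal.coe_sub_bot] at this
      simp at this
  have hle : ∀ x c : ℝ, FLT L x = c → ∀ l ≤ 0, l * x - (L l).toReal ≤ c := by
    intro x c hx l hl
    have := hge x l hl
    rw [hx, hLr l hl, ← EReal.coe_sub, EReal.coe_le_coe_iff] at this
    exact this
  have hc0n : 0 ≤ c0 := by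
    have := hnn D
    rw [hc0] at this
    exact_mod_cast this
  have key := core17 (fun n l => (n : ℝ)⁻¹ * ProbabilityTheory.cgf (Z n) ℙ (n * l))
    (fun l => (L l).toReal)
    (fun l hl => by
      have := hL' l hl
      rw [hLr l hl] at this
      exact EReal.tendsto_coe.1 this)
    (fun n l hl m hm => by
      refine mul_le_mul_of_nonneg_left ?_ (by positivity)
      exact mono17 ℙ (Z n) (hZm n) (hZ0 n) _
        (mul_nonpos_of_nonneg_of_nonpos (by positivity) hl) _
          (mul_le_mul_of_nonneg_left hm (by positivity)))
    (fun n M hM l hl => by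
      rcases Nat.eq_zero_or_pos n with rfl | hn
      · simp
      have hn' : (0 : ℝ) < n := by exact_mod_cast hn
      have := tail17 ℙ (Z n) (hZm n) (hZ0 n) (n * M) (by positivity) (n * l) (by nlinarith)
      rw [show -(n * M : ℝ) = n * -M by ring] at this
      have h2 := mul_le_mul_of_nonneg_left this (by positivity : 0 ≤ (n : ℝ)⁻¹ * (n : ℝ)⁻¹)
      calc -l * ((n : ℝ)⁻¹ * ProbabilityTheory.cgf (Z n) ℙ (n * -M))
          = (n : ℝ)⁻¹ * (n : ℝ)⁻¹ * (-(n * l) * ProbabilityTheory.cgf (Z n) ℙ (n * -M)) := by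
            field_simp
        _ ≤ _ := h2
        _ = _ := by field_simp)
    D D' C c0 hDD (hle D' C hC) (hle D c0 hc0) hc0n
  refine tendsto_of_le_liminf_of_limsup_le ?_ (part1 D)
  rw [hc0]
  refine le_of_forall_lt fun z hz => ?_
  obtain ⟨r, hzr, hr⟩ := EReal.lt_iff_exists_real_btwn.1 hz
  refine lt_of_lt_of_le hzr ?_
  have hr' : 0 < -c0 - r := by
    rw [← EReal.coe_neg, EReal.coe_lt_coe_iff] at hr
    linarith
  refine le_liminf_of_le (by isBoundedDefault) ?_
  filter_upwards [key _ hr', eventually_gt_atTop 0] with n h1 hn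
  rw [EReal.le_neg, ← EReal.coe_neg]
  refine le17 ℙ (Z n) (hZm n) (hZ0 n) n hn D _ fun l hl => ?_
  have := h1 l hl
  linarith

end
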